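/- arXiv:math/0701621 — 4 statements merged into one kernel-verified Lean document; each statement's English description precedes it below -/
import Mathlib

section
/- Let U ⊆ ℝⁿ × ℝᵐ be open, N_i^a : U → ℝ smooth, e_k = ∂/∂xᵏ − Σ_a N_k^a ∂/∂yᵃ, and let g_{ij}, h_{ab} be smooth symmetric matrix fields on U, invertible at every point, with inverses g^{ij}, h^{ab}. Define the canonical d-connection coefficients: L̂^i_{jk} = ½ g^{ir}( e_k g_{jr} + e_j g_{kr} − e_r g_{jk} ); L̂^a_{bk} = ∂N_k^a/∂yᵇ + ½ h^{ac}( e_k h_{bc} − h_{dc} ∂N_k^d/∂yᵇ − h_{db} ∂N_k^d/∂yᶜ ); Ĉ^i_{jc} = ½ g^{ik} ∂g_{jk}/∂yᶜ; Ĉ^a_{bc} = ½ h^{ad}( ∂h_{bd}/∂yᶜ + ∂h_{cd}/∂yᵇ − ∂h_{bc}/∂yᵈ ). Then at every point of U: (i) L̂^i_{jk} = L̂^i_{kj} and Ĉ^a_{bc} = Ĉ^a_{cb} (the torsion components T̂^i_{jk} and T̂^a_{bc} vanish); (ii) e_k g_{jr} = L̂^m_{jk} g_{mr} + L̂^m_{rk}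 g_{jm}; (iii) e_k h_{bc} = L̂^d_{bk} h_{dc} + L̂^d_{ck} h_{db}; (iv) ∂g_{jm}/∂yᶜ = Ĉ^k_{jc} g_{km} + Ĉ^k_{mc} g_{jk}; (v) ∂h_{bd}/∂yᶜ = Ĉ^e_{bc} h_{ed} + Ĉ^e_{dc} h_{be}. That is, the canonical d-connection is metric compatible with the d-metric (g, h) and has vanishing h–h and v–v torsion. -/
set_option autoImplicit false

open scoped BigOperators

/-- Partial derivative of `f : ℝⁿ × ℝᵐ → ℝ` with respect to the horizontal
coordinate `xⁱ`. -/
noncomputable def pdx {n m : ℕ} (f : (Fin n → ℝ) × (Fin m → ℝ) → ℝ) (i : Fin n)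
    (u : (Fin n → ℝ) × (Fin m → ℝ)) : ℝ :=
  fderiv ℝ f u (Pi.single i 1, 0)

/-- Partial derivative of `f : ℝⁿ × ℝᵐ → ℝ` with respect to the vertical
coordinate `yᵃ`. -/
noncomputable def pdy {n m : ℕ} (f : (Fin n → ℝ) × (Fin m → ℝ) → ℝ) (a : Fin m)
    (u : (Fin n → ℝ) × (Fin m → ℝ)) : ℝ :=
  fderiv ℝ f u (0, Pi.single a 1)

/-- The horizontal N-adapted frame operator
`e_i f = ∂f/∂xⁱ − Σ_a N_i^a ∂f/∂yᵃ`. -/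
noncomputable def eH {n m : ℕ}
    (N : Fin n → Fin m → (Fin n → ℝ) × (Fin m → ℝ) → ℝ)
    (f : (Fin n → ℝ) × (Fin m → ℝ) → ℝ) (i : Fin n)
    (u : (Fin n → ℝ) × (Fin m → ℝ)) : ℝ :=
  pdx f i u - ∑ a, N i a u * pdy f a u

/-- `pdy` depends only on the germ of the function. -/
lemma pdy_congr_of_eqOn {n m : ℕ} {U : Set ((Fin n → ℝ) × (Fin m → ℝ))} (hU : IsOpen U)
    {f f' : (Fin n → ℝ) × (Fin m → ℝ) → ℝ} (hff : Set.EqOn f f' U)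
    {u : (Fin n → ℝ) × (Fin m → ℝ)} (hu : u ∈ U) (a : Fin m) :
    pdy f a u = pdy f' a u := by
  unfold pdy
  rw [(hff.eventuallyEq_of_mem (hU.mem_nhds hu)).fderiv_eq]

/-- `eH` depends only on the germ of the function. -/
lemma eH_congr_of_eqOn {n m : ℕ} {U : Set ((Fin n → ℝ) × (Fin m → ℝ))} (hU : IsOpen U)
    (N : Fin n → Fin m → (Fin n → ℝ) × (Fin m → ℝ) → ℝ)
    {f f' : (Fin n → ℝ) × (Fin m → ℝ) → ℝ} (hff : Set.EqOn f f' U)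
    {u : (Fin n → ℝ) × (Fin m → ℝ)} (hu : u ∈ U) (i : Fin n) :
    eH N f i u = eH N f' i u := by
  unfold eH pdx
  rw [(hff.eventuallyEq_of_mem (hU.mem_nhds hu)).fderiv_eq]
  simp only [pdy_congr_of_eqOn hU hff hu]

/-- Lowering an index that was raised with the inverse of a symmetric matrix. -/
lemma Matrix.IsSymm.sum_raise_mul_lower {ι R : Type*} [Fintype ι] [DecidableEq ι] [CommRing R]
    {G H : Matrix ι ι R} (hG : G.IsSymm) (hGH : G * H = 1) (c : R) (A : ι → R) (s : ι) :
    ∑ k, (c * ∑ r, H k r * A r) * G k s = c * A s := by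
  have key : G.mulVec (H.mulVec A) s = A s := by
    rw [Matrix.mulVec_mulVec, hGH, Matrix.one_mulVec]
  rw [← key]
  simp only [Matrix.mulVec, dotProduct]
  rw [Finset.mul_sum]
  refine Finset.sum_congr rfl fun k _ => ?_
  rw [hG.apply s k]
  ring

/-- The canonical d-connection coefficients
`(L̂^i_{jk}, L̂^a_{bk}, Ĉ^i_{jc}, Ĉ^a_{bc})` built from a nonlinear connection
`N` and a d-metric `(g, h)` (smooth, symmetric, invertible) satisfy on `U`:
(i) `L̂^i_{jk} = L̂^i_{kj}` and `Ĉ^a_{bc} = Ĉ^a_{cb}` (vanishing h–h and v–v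
torsion); (ii)–(v) the four metric-compatibility identities
`D(g,h) = 0` in N-adapted form. -/
theorem canonical_d_connection_metric_compatible {n m : ℕ}
    (U : Set ((Fin n → ℝ) × (Fin m → ℝ))) (hU : IsOpen U)
    (N : Fin n → Fin m → (Fin n → ℝ) × (Fin m → ℝ) → ℝ)
    (hN : ∀ i a, ContDiffOn ℝ (⊤ : ℕ∞) (N i a) U)
    (g ginv : (Fin n → ℝ) × (Fin m → ℝ) → Matrix (Fin n) (Fin n) ℝ)
    (h hinv : (Fin n → ℝ) × (Fin m → ℝ) → Matrix (Fin m) (Fin m) ℝ)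
    (hgsym : ∀ u ∈ U, (g u).IsSymm) (hhsym : ∀ u ∈ U, (h u).IsSymm)
    (hgsm : ∀ i j, ContDiffOn ℝ (⊤ : ℕ∞) (fun u => g u i j) U)
    (hhsm : ∀ a b, ContDiffOn ℝ (⊤ : ℕ∞) (fun u => h u a b) U)
    (hginv1 : ∀ u ∈ U, g u * ginv u = 1) (hginv2 : ∀ u ∈ U, ginv u * g u = 1)
    (hhinv1 : ∀ u ∈ U, h u * hinv u = 1) (hhinv2 : ∀ u ∈ U, hinv u * h u = 1)
    (Lh : Fin n → Fin n → Fin n → (Fin n → ℝ) × (Fin m → ℝ) → ℝ)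
    (hLh : ∀ u ∈ U, ∀ i j k, Lh i j k u =
      (1 / 2) * ∑ r, ginv u i r *
        (eH N (fun v => g v j r) k u + eH N (fun v => g v k r) j u
          - eH N (fun v => g v j k) r u))
    (Lv : Fin m → Fin m → Fin n → (Fin n → ℝ) × (Fin m → ℝ) → ℝ)
    (hLv : ∀ u ∈ U, ∀ a b k, Lv a b k u =
      pdy (fun v => N k a v) b u
        + (1 / 2) * ∑ c, hinv u a c *
            (eH N (fun v => h v b c) k u
              - (∑ d, h u d c * pdy (fun v => N k d v) b u)
              - (∑ d, h u d b * pdy (fun v => N k d v) c u)))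
    (Ch : Fin n → Fin n → Fin m → (Fin n → ℝ) × (Fin m → ℝ) → ℝ)
    (hCh : ∀ u ∈ U, ∀ i j c, Ch i j c u =
      (1 / 2) * ∑ k, ginv u i k * pdy (fun v => g v j k) c u)
    (Cv : Fin m → Fin m → Fin m → (Fin n → ℝ) × (Fin m → ℝ) → ℝ)
    (hCv : ∀ u ∈ U, ∀ a b c, Cv a b c u =
      (1 / 2) * ∑ d, hinv u a d *
        (pdy (fun v => h v b d) c u + pdy (fun v => h v c d) b u
          - pdy (fun v => h v b c) d u)) :
    (∀ u ∈ U, (∀ i j k, Lh i j k u = Lh i k j u)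
        ∧ (∀ a b c, Cv a b c u = Cv a c b u))
    ∧ (∀ u ∈ U, ∀ j r k, eH N (fun v => g v j r) k u
        = ∑ m' : Fin n, (Lh m' j k u * g u m' r + Lh m' r k u * g u j m'))
    ∧ (∀ u ∈ U, ∀ b c k, eH N (fun v => h v b c) k u
        = ∑ d, (Lv d b k u * h u d c + Lv d c k u * h u d b))
    ∧ (∀ u ∈ U, ∀ j r c, pdy (fun v => g v j r) c u
        = ∑ k, (Ch k j c u * g u k r + Ch k r c u * g u j k))
    ∧ (∀ u ∈ U, ∀ b d c, pdy (fun v => h v b d) c u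
        = ∑ e' : Fin m, (Cv e' b c u * h u e' d + Cv e' d c u * h u b e')) := by
  have eg : ∀ u ∈ U, ∀ i j k, eH N (fun v => g v i j) k u = eH N (fun v => g v j i) k u :=
    fun u hu i j k => eH_congr_of_eqOn hU N (fun v hv => (hgsym v hv).apply j i) hu k
  have eh : ∀ u ∈ U, ∀ a b k, eH N (fun v => h v a b) k u = eH N (fun v => h v b a) k u :=
    fun u hu a b k => eH_congr_of_eqOn hU N (fun v hv => (hhsym v hv).apply b a) hu k
  have pg : ∀ u ∈ U, ∀ i j c, pdy (fun v => g v i j) c u = pdy (fun v => g v j i) c u :=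
    fun u hu i j c => pdy_congr_of_eqOn hU (fun v hv => (hgsym v hv).apply j i) hu c
  have ph : ∀ u ∈ U, ∀ a b c, pdy (fun v => h v a b) c u = pdy (fun v => h v b a) c u :=
    fun u hu a b c => pdy_congr_of_eqOn hU (fun v hv => (hhsym v hv).apply b a) hu c
  refine ⟨fun u hu => ⟨fun i j k => ?_, fun a b c => ?_⟩, fun u hu j r k => ?_,
    fun u hu b c k => ?_, fun u hu j r c => ?_, fun u hu b d c => ?_⟩
  · rw [hLh u hu, hLh u hu]
    congr 1
    refine Finset.sum_congr rfl fun r _ => ?_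
    rw [eg u hu j k r]
    ring
  · rw [hCv u hu, hCv u hu]
    congr 1
    refine Finset.sum_congr rfl fun d _ => ?_
    rw [ph u hu b c d]
    ring
  · simp only [fun i => (hgsym u hu).apply i j, hLh u hu, Finset.sum_add_distrib]
    rw [(hgsym u hu).sum_raise_mul_lower (hginv1 u hu),
      (hgsym u hu).sum_raise_mul_lower (hginv1 u hu),
      eg u hu r j k, eg u hu k j r, eg u hu k r j]
    ring
  · simp only [hLv u hu, add_mul, Finset.sum_add_distrib]
    rw [(hhsym u hu).sum_raise_mul_lower (hhinv1 u hu),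
      (hhsym u hu).sum_raise_mul_lower (hhinv1 u hu), eh u hu c b k]
    simp only [mul_comm (h u _ _)]
    ring
  · simp only [fun i => (hgsym u hu).apply i j, hCh u hu, Finset.sum_add_distrib]
    rw [(hgsym u hu).sum_raise_mul_lower (hginv1 u hu),
      (hgsym u hu).sum_raise_mul_lower (hginv1 u hu), pg u hu r j c]
    ring
  · simp only [fun i => (hhsym u hu).apply i b, hCv u hu, Finset.sum_add_distrib]
    rw [(hhsym u hu).sum_raise_mul_lower (hhinv1 u hu),
      (hhsym u hu).sum_raise_mul_lower (hhinv1 u hu),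
      ph u hu d b c, ph u hu c b d, ph u hu c d b]
    ring
end

section
/- Let η be a constant symmetric invertible real N×N matrix, I ⊆ ℝ an open interval, R : I → (symmetric N×N real matrices) continuous, and A : I → GL(N, ℝ) differentiable, and set g(χ) := A(χ) η A(χ)ᵀ (which is symmetric and invertible for all χ). If A satisfies the frame-evolution equation A′(χ) = − R(χ) g(χ)⁻¹ A(χ) for all χ ∈ I, then the metric g satisfies the Ricci-flow-type equation g′(χ) = −2 R(χ) for all χ ∈ I. -/
set_option autoImplicit false

open scoped BigOperators Matrix

/-- Entrywise product rule for `A η Aᵀ` with `η` constant. -/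
theorem hasDerivAt_mul_const_mul_transpose_apply {m n : Type*} [Fintype n]
    {A : ℝ → Matrix m n ℝ} {A' : Matrix m n ℝ} (η : Matrix n n ℝ) {x : ℝ}
    (hA : ∀ i j, HasDerivAt (fun t => A t i j) (A' i j) x) (i j : m) :
    HasDerivAt (fun t => (A t * η * (A t)ᵀ) i j)
      ((A' * η * (A x)ᵀ + A x * η * A'ᵀ) i j) x := by
  simp only [Matrix.add_apply, Matrix.mul_apply, Matrix.transpose_apply,
    ← Finset.sum_add_distrib]
  exact HasDerivAt.fun_sum fun k _ =>
    (HasDerivAt.fun_sum fun l _ => (hA i l).mul_const (η l k)).mul (hA j k)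

/-- Let `η` be a constant symmetric invertible matrix,
`R : I → ℝ^{N×N}` continuous with symmetric values, `A : I → GL(N, ℝ)`
differentiable, and `g(χ) = A(χ) η A(χ)ᵀ`. If `A` satisfies the
frame-evolution equation `A′(χ) = −R(χ) g(χ)⁻¹ A(χ)` on the open interval `I`,
then `g′(χ) = −2 R(χ)` on `I`. -/
theorem frame_evolution_implies_ricci_flow {N : ℕ} (p q : ℝ)
    (η : Matrix (Fin N) (Fin N) ℝ) (hηsym : η.IsSymm) (hηunit : IsUnit η)
    (R A : ℝ → Matrix (Fin N) (Fin N) ℝ)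
    (hRcont : ∀ i j, ContinuousOn (fun χ => R χ i j) (Set.Ioo p q))
    (hRsym : ∀ χ ∈ Set.Ioo p q, (R χ).IsSymm)
    (hAunit : ∀ χ ∈ Set.Ioo p q, IsUnit (A χ))
    (g : ℝ → Matrix (Fin N) (Fin N) ℝ)
    (hgdef : ∀ χ, g χ = A χ * η * (A χ)ᵀ)
    (hAflow : ∀ χ ∈ Set.Ioo p q, ∀ i j,
      HasDerivAt (fun t => A t i j) ((-(R χ * (g χ)⁻¹ * A χ)) i j) χ) :
    ∀ χ ∈ Set.Ioo p q, ∀ i j,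
      HasDerivAt (fun t => g t i j) (-2 * R χ i j) χ := by
  intro χ hχ i j
  have hunit : IsUnit (g χ) := by
    rw [hgdef]
    exact ((hAunit χ hχ).mul hηunit).mul
      ((Matrix.isUnit_transpose (A χ)).mpr (hAunit χ hχ))
  have hleft : -(R χ * (g χ)⁻¹ * A χ) * η * (A χ)ᵀ = -R χ := by
    have hassoc : -(R χ * (g χ)⁻¹ * A χ) * η * (A χ)ᵀ =
        -(R χ * ((g χ)⁻¹ * (A χ * η * (A χ)ᵀ))) := by
      simp only [Matrix.neg_mul, Matrix.mul_assoc]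
    rw [hassoc, ← hgdef,
      Matrix.nonsing_inv_mul _ ((Matrix.isUnit_iff_isUnit_det _).mp hunit), Matrix.mul_one]
  have hright : A χ * η * (-(R χ * (g χ)⁻¹ * A χ))ᵀ = -R χ := by
    have h := congrArg Matrix.transpose hleft
    rwa [Matrix.transpose_mul, Matrix.transpose_mul, Matrix.transpose_transpose, hηsym.eq,
      ← Matrix.mul_assoc, Matrix.transpose_neg (R χ), (hRsym χ hχ).eq] at h
  have hderiv := hasDerivAt_mul_const_mul_transpose_apply η (hAflow χ hχ) i j
  rw [hleft, hright] at hderiv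
  simp only [hgdef]
  convert hderiv using 1
  simp only [Matrix.add_apply, Matrix.neg_apply]
  ring
end

section
/- Let U ⊆ ℝⁿ × ℝᵐ be open, N_i^a : U → ℝ smooth, and let g_{ij}, h_{ab} be smooth symmetric matrix fields on U, invertible at every point. Let G̲ be the Sasaki-type metric with blocks G̲_{ij} = g_{ij} + N_i^a N_j^b h_{ab}, G̲_{ib} = N_i^a h_{ab}, G̲_{ab} = h_{ab} (invertible at every point), and let Γ̲^{γ̲}_{α̲β̲} = ½ Σ_{δ̲} G̲^{γ̲δ̲} ( ∂_{α̲} G̲_{β̲δ̲} + ∂_{β̲} G̲_{α̲δ̲} − ∂_{δ̲} G̲_{α̲β̲} ) be its coordinate Christoffel symbols. Then for all horizontal indices i, j, k and every point of U, the h–h–h N-adapted frame coefficient of the Levi–Civita connection equals the canonical d-connection coefficient: Γ̲^i_{jk} − Σ_b N_j^b Γ̲^i_{bk} − Σ_b N_k^b Γ̲^i_{jb} + Σ_{b,c} N_j^b N_k^c Γ̲^i_{bc} = L̂^i_{jk}, where L̂^i_{jk} = ½ Σ_r g^{ir}( e_k g_{jr} + e_j g_{kr} − e_r g_{jk} ) and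 e_k = ∂/∂xᵏ − Σ_a N_k^a ∂/∂yᵃ. Equivalently, the distortion tensor component ₗZ^i_{jk} of the Levi–Civita connection relative to the canonical d-connection vanishes. -/
set_option autoImplicit false

open scoped BigOperators

/-- Coordinate partial derivative indexed by a combined index
`α̲ ∈ {1,…,n} ⊕ {1,…,m}`. -/
noncomputable def pd {n m : ℕ} (α : Fin n ⊕ Fin m)
    (f : (Fin n → ℝ) × (Fin m → ℝ) → ℝ)
    (u : (Fin n → ℝ) × (Fin m → ℝ)) : ℝ :=
  match α with
  | Sum.inl i => pdx f i u
  | Sum.inr a => pdy f a u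

/-- Coordinate components of the horizontal N-adapted frame vector `e_j`, given the values
of the nonlinear connection at a point. -/
noncomputable def horizontalFrame {n m : ℕ} (N : Fin n → Fin m → ℝ) (j : Fin n) :
    Fin n ⊕ Fin m → ℝ :=
  Sum.elim (Pi.single j 1) (fun a => -N j a)

lemma sum_horizontalFrame_mul {n m : ℕ} (N : Fin n → Fin m → ℝ) (j : Fin n)
    (f : Fin n ⊕ Fin m → ℝ) :
    ∑ α, horizontalFrame N j α * f α = f (Sum.inl j) - ∑ a, N j a * f (Sum.inr a) := by
  simp [horizontalFrame, Fintype.sum_sum_type, Pi.single_apply, sub_eq_add_neg]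

lemma eH_eq_sum_horizontalFrame {n m : ℕ}
    (N : Fin n → Fin m → (Fin n → ℝ) × (Fin m → ℝ) → ℝ)
    (f : (Fin n → ℝ) × (Fin m → ℝ) → ℝ) (j : Fin n) (u : (Fin n → ℝ) × (Fin m → ℝ)) :
    eH N f j u = ∑ α, horizontalFrame (fun i a => N i a u) j α * pd α f u := by
  rw [sum_horizontalFrame_mul]
  rfl

lemma exists_pd_eq_fderiv {n m : ℕ} (α : Fin n ⊕ Fin m) :
    ∃ w, ∀ (f : (Fin n → ℝ) × (Fin m → ℝ) → ℝ) u, pd α f u = fderiv ℝ f u w := by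
  cases α with
  | inl i => exact ⟨_, fun _ _ => rfl⟩
  | inr a => exact ⟨_, fun _ _ => rfl⟩

/-- Algebraic form of the Leibniz rule for a Sasaki-type metric: the `h`- and `N`-dependent
terms cancel when a derivative of the metric is contracted with two horizontal vectors. -/
lemma sasaki_leibniz_cancel {m : ℕ} (x : ℝ) (p q dp dq : Fin m → ℝ) (h dh : Fin m → Fin m → ℝ)
    (hs : ∀ a b, h a b = h b a) (dhs : ∀ a b, dh a b = dh b a) :
    (x + ∑ a, ∑ b, ((dp a * q b + p a * dq b) * h a b + p a * q b * dh a b))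
      - ∑ b, q b * ∑ a, (dp a * h a b + p a * dh a b)
      - ∑ b, p b * (∑ a, (dq a * h a b + q a * dh a b) - ∑ c, q c * dh b c) = x := by
  have h₁ : ∑ b, q b * ∑ a, (dp a * h a b + p a * dh a b)
      = ∑ a, ∑ b, (dp a * q b * h a b + p a * q b * dh a b) := by
    simp only [Finset.mul_sum]
    rw [Finset.sum_comm]
    exact Finset.sum_congr rfl fun a _ => Finset.sum_congr rfl fun b _ => by ring
  have h₂ : ∑ b, p b * (∑ a, (dq a * h a b + q a * dh a b) - ∑ c, q c * dh b c)
      = ∑ a, ∑ b, p a * dq b * h a b := by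
    simp only [← Finset.sum_sub_distrib, Finset.mul_sum]
    refine Finset.sum_congr rfl fun a _ => Finset.sum_congr rfl fun b _ => ?_
    rw [hs b a, dhs b a]
    ring
  rw [h₁, h₂, add_sub_assoc, add_sub_assoc, ← Finset.sum_sub_distrib, ← Finset.sum_sub_distrib,
    Finset.sum_eq_zero, add_zero]
  intro a _
  rw [← Finset.sum_sub_distrib, ← Finset.sum_sub_distrib]
  exact Finset.sum_eq_zero fun b _ => by ring

/-- Contracting a derivative of a Sasaki-type metric with two horizontal frame vectors gives
the derivative of its horizontal block. -/
lemma sum_horizontalFrame_pd_metric {n m : ℕ} {u : (Fin n → ℝ) × (Fin m → ℝ)}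
    {N : Fin n → Fin m → (Fin n → ℝ) × (Fin m → ℝ) → ℝ}
    {g : (Fin n → ℝ) × (Fin m → ℝ) → Matrix (Fin n) (Fin n) ℝ}
    {h : (Fin n → ℝ) × (Fin m → ℝ) → Matrix (Fin m) (Fin m) ℝ}
    {G : (Fin n → ℝ) × (Fin m → ℝ) → Matrix (Fin n ⊕ Fin m) (Fin n ⊕ Fin m) ℝ}
    (hN : ∀ i a, DifferentiableAt ℝ (N i a) u)
    (hg : ∀ i j, DifferentiableAt ℝ (fun v => g v i j) u)
    (hh : ∀ a b, DifferentiableAt ℝ (fun v => h v a b) u)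
    (hsymm : ∀ᶠ v in nhds u, (h v).IsSymm)
    (hG₁ : ∀ v i j, G v (Sum.inl i) (Sum.inl j) = g v i j + ∑ a, ∑ b, N i a v * N j b v * h v a b)
    (hG₂ : ∀ v i b, G v (Sum.inl i) (Sum.inr b) = ∑ a, N i a v * h v a b)
    (hG₃ : ∀ v i b, G v (Sum.inr b) (Sum.inl i) = ∑ a, N i a v * h v a b)
    (hG₄ : ∀ v a b, G v (Sum.inr a) (Sum.inr b) = h v a b)
    (α : Fin n ⊕ Fin m) (k r : Fin n) :
    ∑ β, horizontalFrame (fun i a => N i a u) k β *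
      ∑ δ, horizontalFrame (fun i a => N i a u) r δ * pd α (fun v => G v β δ) u
      = pd α (fun v => g v k r) u := by
  obtain ⟨w, hw⟩ := exists_pd_eq_fderiv α
  have hNh : ∀ i b, fderiv ℝ (fun v => ∑ a, N i a v * h v a b) u w
      = ∑ a, (fderiv ℝ (N i a) u w * h u a b + N i a u * fderiv ℝ (fun v => h v a b) u w) := by
    intro i b
    refine (DFunLike.congr_fun (HasFDerivAt.fun_sum fun a _ =>
      (hN i a).hasFDerivAt.mul (hh a b).hasFDerivAt).fderiv w).trans ?_
    simp only [sum_apply, add_apply,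
      smul_apply, smul_eq_mul]
    exact Finset.sum_congr rfl fun a _ => by ring
  have hgNNh : fderiv ℝ (fun v => g v k r + ∑ a, ∑ b, N k a v * N r b v * h v a b) u w
      = fderiv ℝ (fun v => g v k r) u w + ∑ a, ∑ b,
        ((fderiv ℝ (N k a) u w * N r b u + N k a u * fderiv ℝ (N r b) u w) * h u a b
          + N k a u * N r b u * fderiv ℝ (fun v => h v a b) u w) := by
    refine (DFunLike.congr_fun ((hg k r).hasFDerivAt.add (HasFDerivAt.fun_sum fun a _ =>
      HasFDerivAt.fun_sum fun b _ =>
        ((hN k a).hasFDerivAt.mul (hN r b).hasFDerivAt).mul (hh a b).hasFDerivAt)).fderiv w).trans ?_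
    simp only [sum_apply, add_apply,
      smul_apply, smul_eq_mul]
    congr 1
    exact Finset.sum_congr rfl fun a _ => Finset.sum_congr rfl fun b _ => by
      simp only [Pi.mul_apply]; ring
  simp only [sum_horizontalFrame_mul, hw, hG₁, hG₂, hG₃, hG₄, hNh, hgNNh]
  refine sasaki_leibniz_cancel _ (fun a => N k a u) (fun a => N r a u)
    (fun a => fderiv ℝ (N k a) u w) (fun a => fderiv ℝ (N r a) u w) (fun a b => h u a b)
    (fun a b => fderiv ℝ (fun v => h v a b) u w) (fun a b => hsymm.self_of_nhds.apply b a)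
    fun a b => ?_
  have hab : (fun v => h v a b) =ᶠ[nhds u] fun v => h v b a :=
    hsymm.mono fun v hv => hv.apply b a
  simp only [hab.fderiv_eq]

/-- The horizontal rows of the inverse of a Sasaki-type metric. -/
lemma inv_sasaki_inl_apply {n m : ℕ} {N : Fin n → Fin m → ℝ}
    {g ginv : Matrix (Fin n) (Fin n) ℝ} {h : Matrix (Fin m) (Fin m) ℝ}
    {G Ginv : Matrix (Fin n ⊕ Fin m) (Fin n ⊕ Fin m) ℝ}
    (hsymm : h.IsSymm) (hg : ginv * g = 1) (hGinv : G * Ginv = 1)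
    (hG₁ : ∀ i j, G (Sum.inl i) (Sum.inl j) = g i j + ∑ a, ∑ b, N i a * N j b * h a b)
    (hG₂ : ∀ i b, G (Sum.inl i) (Sum.inr b) = ∑ a, N i a * h a b)
    (hG₃ : ∀ i b, G (Sum.inr b) (Sum.inl i) = ∑ a, N i a * h a b)
    (hG₄ : ∀ a b, G (Sum.inr a) (Sum.inr b) = h a b) (i : Fin n) (δ : Fin n ⊕ Fin m) :
    Ginv (Sum.inl i) δ = ∑ r, ginv i r * horizontalFrame N r δ := by
  let E : Matrix (Fin n) (Fin n ⊕ Fin m) ℝ := Matrix.of (horizontalFrame N)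
  let P : Matrix (Fin n) (Fin n ⊕ Fin m) ℝ := Matrix.fromCols 1 0
  have hE : E * G = (Matrix.fromCols g 0 : Matrix (Fin n) (Fin n ⊕ Fin m) ℝ) := by
    ext r β
    rw [Matrix.mul_apply]
    refine (sum_horizontalFrame_mul N r fun δ => G δ β).trans ?_
    cases β with
    | inl j =>
      simp only [hG₁, hG₃, Matrix.fromCols_apply_inl, add_sub_assoc, Finset.mul_sum,
        ← Finset.sum_sub_distrib]
      rw [Finset.sum_eq_zero, add_zero]
      exact fun a _ => Finset.sum_eq_zero fun b _ => by rw [hsymm.apply a b]; ring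
    | inr b =>
      simp only [hG₂, hG₄, Matrix.fromCols_apply_inr, sub_self, Matrix.zero_apply]
  have hP : ginv * E * G = P := by
    rw [Matrix.mul_assoc, hE, Matrix.mul_fromCols, hg, Matrix.mul_zero]
  have key : ginv * E = P * Ginv := by
    rw [← hP, Matrix.mul_assoc, hGinv, Matrix.mul_one]
  have hi := congrFun (congrFun key i) δ
  simp only [P, Matrix.mul_apply, Fintype.sum_sum_type, Matrix.fromCols_apply_inl,
    Matrix.fromCols_apply_inr, Matrix.one_apply, Matrix.zero_apply, ite_mul, one_mul, zero_mul,
    Finset.sum_ite_eq, Finset.mem_univ, if_true, Finset.sum_const_zero, add_zero] at hi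
  exact hi.symm

/-- Distributing a bilinear contraction over a Christoffel-type expression. -/
lemma sum_christoffel_contract {ι κ : Type*} [Fintype ι] [Fintype κ] (c : κ → ℝ) (e : κ → ι → ℝ)
    (p q : ι → ℝ) (T : ι → ι → ι → ℝ) :
    ∑ α, p α * ∑ β, q β * ((1 / 2) * ∑ δ, (∑ r, c r * e r δ) * (T α β δ + T β α δ - T δ α β))
      = (1 / 2) * ∑ r, c r * (∑ β, q β * ∑ α, p α * ∑ δ, e r δ * T β α δ
          + ∑ α, p α * ∑ β, q β * ∑ δ, e r δ * T α β δ
          - ∑ δ, e r δ * ∑ α, p α * ∑ β, q β * T δ α β) := by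
  have h₁ : ∀ r, ∑ β, q β * ∑ α, p α * ∑ δ, e r δ * T β α δ
      = ∑ α, ∑ β, ∑ δ, p α * q β * e r δ * T β α δ := fun r => by
    simp only [Finset.mul_sum]
    rw [Finset.sum_comm]
    exact Finset.sum_congr rfl fun _ _ => Finset.sum_congr rfl fun _ _ =>
      Finset.sum_congr rfl fun _ _ => by ring
  have h₂ : ∀ r, ∑ δ, e r δ * ∑ α, p α * ∑ β, q β * T δ α β
      = ∑ α, ∑ β, ∑ δ, p α * q β * e r δ * T δ α β := fun r => by
    simp only [Finset.mul_sum]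
    rw [Finset.sum_comm]
    refine Finset.sum_congr rfl fun _ _ => ?_
    rw [Finset.sum_comm]
    exact Finset.sum_congr rfl fun _ _ => Finset.sum_congr rfl fun _ _ => by ring
  have swap : ∀ f : κ → ι → ℝ, ∑ r, ∑ α, f r α = ∑ α, ∑ r, f r α := fun _ => Finset.sum_comm
  simp only [h₁, h₂]
  simp only [Finset.mul_sum, Finset.sum_mul, ← Finset.sum_add_distrib, ← Finset.sum_sub_distrib,
    swap]
  exact Finset.sum_congr rfl fun _ _ => Finset.sum_congr rfl fun _ _ =>
    Finset.sum_congr rfl fun _ _ => Finset.sum_congr rfl fun _ _ => by ring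

/-- For the Sasaki-type metric `G̲` built from `(g, h, N)`
(all smooth, `g`, `h`, `G̲` everywhere invertible on `U`) with coordinate
Christoffel symbols `Γ̲^{γ̲}_{α̲β̲}`, the h–h–h N-adapted frame coefficient of
the Levi–Civita connection equals the canonical d-connection coefficient:
`Γ̲^i_{jk} − Σ_b N_j^b Γ̲^i_{bk} − Σ_b N_k^b Γ̲^i_{jb}
 + Σ_{b,c} N_j^b N_k^c Γ̲^i_{bc} = L̂^i_{jk}` on `U`; i.e. the distortion
component `ₗZ^i_{jk}` vanishes. -/
theorem levi_civita_hhh_equals_canonical {n m : ℕ}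
    (U : Set ((Fin n → ℝ) × (Fin m → ℝ))) (hU : IsOpen U)
    (N : Fin n → Fin m → (Fin n → ℝ) × (Fin m → ℝ) → ℝ)
    (hN : ∀ i a, ContDiffOn ℝ (⊤ : ℕ∞) (N i a) U)
    (g ginv : (Fin n → ℝ) × (Fin m → ℝ) → Matrix (Fin n) (Fin n) ℝ)
    (h hinv : (Fin n → ℝ) × (Fin m → ℝ) → Matrix (Fin m) (Fin m) ℝ)
    (hgsym : ∀ u ∈ U, (g u).IsSymm) (hhsym : ∀ u ∈ U, (h u).IsSymm)
    (hgsm : ∀ i j, ContDiffOn ℝ (⊤ : ℕ∞) (fun u => g u i j) U)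
    (hhsm : ∀ a b, ContDiffOn ℝ (⊤ : ℕ∞) (fun u => h u a b) U)
    (hginv1 : ∀ u ∈ U, g u * ginv u = 1) (hginv2 : ∀ u ∈ U, ginv u * g u = 1)
    (hhinv1 : ∀ u ∈ U, h u * hinv u = 1) (hhinv2 : ∀ u ∈ U, hinv u * h u = 1)
    (Gbar GbarInv : (Fin n → ℝ) × (Fin m → ℝ) →
      Matrix (Fin n ⊕ Fin m) (Fin n ⊕ Fin m) ℝ)
    (hGb1 : ∀ u, ∀ i j, Gbar u (Sum.inl i) (Sum.inl j)
      = g u i j + ∑ a, ∑ b, N i a u * N j b u * h u a b)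
    (hGb2 : ∀ u, ∀ i b, Gbar u (Sum.inl i) (Sum.inr b)
      = ∑ a, N i a u * h u a b)
    (hGb3 : ∀ u, ∀ i b, Gbar u (Sum.inr b) (Sum.inl i)
      = ∑ a, N i a u * h u a b)
    (hGb4 : ∀ u, ∀ a b, Gbar u (Sum.inr a) (Sum.inr b) = h u a b)
    (hGbinv1 : ∀ u ∈ U, Gbar u * GbarInv u = 1)
    (hGbinv2 : ∀ u ∈ U, GbarInv u * Gbar u = 1)
    (Γ : (Fin n ⊕ Fin m) → (Fin n ⊕ Fin m) → (Fin n ⊕ Fin m) →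
      (Fin n → ℝ) × (Fin m → ℝ) → ℝ)
    (hΓ : ∀ u ∈ U, ∀ γ α β, Γ γ α β u =
      (1 / 2) * ∑ δ, GbarInv u γ δ *
        (pd α (fun v => Gbar v β δ) u + pd β (fun v => Gbar v α δ) u
          - pd δ (fun v => Gbar v α β) u))
    (Lhat : Fin n → Fin n → Fin n → (Fin n → ℝ) × (Fin m → ℝ) → ℝ)
    (hLhat : ∀ u ∈ U, ∀ i j k, Lhat i j k u =
      (1 / 2) * ∑ r, ginv u i r *
        (eH N (fun v => g v j r) k u + eH N (fun v => g v k r) j u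
          - eH N (fun v => g v j k) r u)) :
    ∀ u ∈ U, ∀ i j k : Fin n,
      Γ (Sum.inl i) (Sum.inl j) (Sum.inl k) u
          - (∑ b, N j b u * Γ (Sum.inl i) (Sum.inr b) (Sum.inl k) u)
          - (∑ b, N k b u * Γ (Sum.inl i) (Sum.inl j) (Sum.inr b) u)
          + (∑ b, ∑ c, N j b u * N k c u * Γ (Sum.inl i) (Sum.inr b) (Sum.inr c) u)
        = Lhat i j k u := by
  intro u hu i j k
  have hUu : U ∈ nhds u := hU.mem_nhds hu
  have diff : ∀ {f : (Fin n → ℝ) × (Fin m → ℝ) → ℝ}, ContDiffOn ℝ (⊤ : ℕ∞) f U →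
      DifferentiableAt ℝ f u := fun hf => (hf.contDiffAt hUu).differentiableAt (by simp)
  have metric := sum_horizontalFrame_pd_metric (fun i a => diff (hN i a))
    (fun i j => diff (hgsm i j)) (fun a b => diff (hhsm a b))
    (Filter.mem_of_superset hUu hhsym) hGb1 hGb2 hGb3 hGb4
  have inv := inv_sasaki_inl_apply (hhsym u hu) (hginv2 u hu) (hGbinv1 u hu) (hGb1 u) (hGb2 u)
    (hGb3 u) (hGb4 u)
  let e := horizontalFrame fun i a => N i a u
  calc
    _ = ∑ α, e j α * ∑ β, e k β * Γ (Sum.inl i) α β u := by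
      simp only [e, sum_horizontalFrame_mul]
      simp only [mul_sub, Finset.sum_sub_distrib, Finset.mul_sum,
        mul_assoc]
      ring
    _ = _ := by
      simp only [hΓ u hu, inv]
      rw [sum_christoffel_contract (ginv u i) e (e j) (e k)
        fun α β δ => pd α (fun v => Gbar v β δ) u, hLhat u hu]
      simp only [eH_eq_sum_horizontalFrame, ← metric]
      rfl
end

section
/- Let U ⊆ ℝⁿ × ℝᵐ be open, N_i^a : U → ℝ smooth, and let g_{ij}, h_{ab} be smooth symmetric matrix fields on U, invertible at every point. Let G̲ be the Sasaki-type metric with blocks G̲_{ij} = g_{ij} + N_i^a N_j^b h_{ab}, G̲_{ib} = N_i^a h_{ab}, G̲_{ab} = h_{ab} (invertible at every point), and let Γ̲^{γ̲}_{α̲β̲} be its coordinate Christoffel symbols. Then for all vertical indices a, b, c and every point of U, the v–v–v N-adapted frame coefficient of the Levi–Civita connection equals the canonical d-connection coefficient: Γ̲^a_{bc} + Σ_j N_j^a Γ̲^j_{bc} = Ĉ^a_{bc}, where Ĉ^a_{bc} = ½ Σ_d h^{ad}( ∂h_{bd}/∂yᶜ + ∂h_{cd}/∂yᵇ − ∂h_{bc}/∂yᵈ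 ) and the lower indices b, c on Γ̲ refer to the vertical coordinate directions ∂/∂yᵇ, ∂/∂yᶜ. Equivalently, the distortion tensor component ₗZ^a_{bc} of the Levi–Civita connection relative to the canonical d-connection vanishes. -/
set_option autoImplicit false

open scoped BigOperators

open Matrix in
/-- The covector `dyᵃ + N_jᵃ dxʲ`, raised with the inverse of a Sasaki-type metric, is the vertical
vector whose components are the `a`-th row of the inverse of the vertical block. -/
theorem Matrix.sumElim_vecMul_sasaki_inv {ι κ R : Type*} [Fintype ι] [Fintype κ] [DecidableEq ι]
    [DecidableEq κ] [CommRing R] {h hinv : Matrix κ κ R} (hsymm : h.IsSymm) (hinv_mul : hinv * h = 1)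
    {G Ginv : Matrix (ι ⊕ κ) (ι ⊕ κ) R} (hG : G * Ginv = 1) (N : ι → κ → R)
    (hvh : ∀ i b, G (Sum.inr b) (Sum.inl i) = ∑ a, N i a * h a b)
    (hvv : ∀ a b, G (Sum.inr a) (Sum.inr b) = h a b) (a : κ) :
    Sum.elim (fun i => N i a) (Pi.single a 1) ᵥ* Ginv = Sum.elim (fun _ => 0) (hinv a) := by
  have row (e : κ) : ∑ d, hinv a d * h d e = if a = e then 1 else 0 := by
    rw [← Matrix.mul_apply, hinv_mul, Matrix.one_apply]
  have key : Sum.elim (fun _ => 0) (hinv a) ᵥ* G = Sum.elim (fun i => N i a) (Pi.single a 1) := by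
    ext (i | b)
    · simp only [vecMul, dotProduct, Fintype.sum_sum_type, Sum.elim_inl, Sum.elim_inr,
        zero_mul, Finset.sum_const_zero, zero_add, hvh, Finset.mul_sum]
      rw [Finset.sum_comm]
      calc ∑ e, ∑ d, hinv a d * (N i e * h e d)
          = ∑ e, N i e * ∑ d, hinv a d * h d e := by
            refine Finset.sum_congr rfl fun e _ => ?_
            rw [Finset.mul_sum]
            refine Finset.sum_congr rfl fun d _ => ?_
            rw [hsymm.apply d e]
            ring
        _ = N i a := by simp [row]
    · simp [vecMul, dotProduct, Fintype.sum_sum_type, hvv, row, Pi.single_apply, eq_comm]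
  rw [← key, Matrix.vecMul_vecMul, hG, Matrix.vecMul_one]

/-- For the Sasaki-type metric `G̲` built from `(g, h, N)`
(all smooth, `g`, `h`, `G̲` everywhere invertible on `U`) with coordinate
Christoffel symbols `Γ̲^{γ̲}_{α̲β̲}`, the v–v–v N-adapted frame coefficient of
the Levi–Civita connection equals the canonical d-connection coefficient:
`Γ̲^a_{bc} + Σ_j N_j^a Γ̲^j_{bc} = Ĉ^a_{bc}` on `U`; i.e. the distortion
component `ₗZ^a_{bc}` vanishes. -/
theorem levi_civita_vvv_equals_canonical {n m : ℕ}
    (U : Set ((Fin n → ℝ) × (Fin m → ℝ))) (hU : IsOpen U)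
    (N : Fin n → Fin m → (Fin n → ℝ) × (Fin m → ℝ) → ℝ)
    (hN : ∀ i a, ContDiffOn ℝ (⊤ : ℕ∞) (N i a) U)
    (g ginv : (Fin n → ℝ) × (Fin m → ℝ) → Matrix (Fin n) (Fin n) ℝ)
    (h hinv : (Fin n → ℝ) × (Fin m → ℝ) → Matrix (Fin m) (Fin m) ℝ)
    (hgsym : ∀ u ∈ U, (g u).IsSymm) (hhsym : ∀ u ∈ U, (h u).IsSymm)
    (hgsm : ∀ i j, ContDiffOn ℝ (⊤ : ℕ∞) (fun u => g u i j) U)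
    (hhsm : ∀ a b, ContDiffOn ℝ (⊤ : ℕ∞) (fun u => h u a b) U)
    (hginv1 : ∀ u ∈ U, g u * ginv u = 1) (hginv2 : ∀ u ∈ U, ginv u * g u = 1)
    (hhinv1 : ∀ u ∈ U, h u * hinv u = 1) (hhinv2 : ∀ u ∈ U, hinv u * h u = 1)
    (Gbar GbarInv : (Fin n → ℝ) × (Fin m → ℝ) →
      Matrix (Fin n ⊕ Fin m) (Fin n ⊕ Fin m) ℝ)
    (hGb1 : ∀ u, ∀ i j, Gbar u (Sum.inl i) (Sum.inl j)
      = g u i j + ∑ a, ∑ b, N i a u * N j b u * h u a b)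
    (hGb2 : ∀ u, ∀ i b, Gbar u (Sum.inl i) (Sum.inr b)
      = ∑ a, N i a u * h u a b)
    (hGb3 : ∀ u, ∀ i b, Gbar u (Sum.inr b) (Sum.inl i)
      = ∑ a, N i a u * h u a b)
    (hGb4 : ∀ u, ∀ a b, Gbar u (Sum.inr a) (Sum.inr b) = h u a b)
    (hGbinv1 : ∀ u ∈ U, Gbar u * GbarInv u = 1)
    (hGbinv2 : ∀ u ∈ U, GbarInv u * Gbar u = 1)
    (Γ : (Fin n ⊕ Fin m) → (Fin n ⊕ Fin m) → (Fin n ⊕ Fin m) →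
      (Fin n → ℝ) × (Fin m → ℝ) → ℝ)
    (hΓ : ∀ u ∈ U, ∀ γ α β, Γ γ α β u =
      (1 / 2) * ∑ δ, GbarInv u γ δ *
        (pd α (fun v => Gbar v β δ) u + pd β (fun v => Gbar v α δ) u
          - pd δ (fun v => Gbar v α β) u))
    (Chat : Fin m → Fin m → Fin m → (Fin n → ℝ) × (Fin m → ℝ) → ℝ)
    (hChat : ∀ u ∈ U, ∀ a b c, Chat a b c u =
      (1 / 2) * ∑ d, hinv u a d *
        (pdy (fun v => h v b d) c u + pdy (fun v => h v c d) b u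
          - pdy (fun v => h v b c) d u)) :
    ∀ u ∈ U, ∀ a b c : Fin m,
      Γ (Sum.inr a) (Sum.inr b) (Sum.inr c) u
          + (∑ j, N j a u * Γ (Sum.inl j) (Sum.inr b) (Sum.inr c) u)
        = Chat a b c u := by
  intro u hu a b c
  have raise := Matrix.sumElim_vecMul_sasaki_inv (hhsym u hu) (hhinv2 u hu) (hGbinv1 u hu)
    (fun i e => N i e u) (hGb3 u) (hGb4 u) a
  have row (δ : Fin n ⊕ Fin m) : GbarInv u (Sum.inr a) δ + ∑ j, N j a u * GbarInv u (Sum.inl j) δ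
      = Sum.elim (fun _ => 0) (hinv u a) δ := by
    rw [← raise]
    simp [Matrix.vecMul, dotProduct, Fintype.sum_sum_type, Pi.single_apply, add_comm]
  have contract (S : Fin n ⊕ Fin m → ℝ) :
      (1 / 2) * ∑ δ, GbarInv u (Sum.inr a) δ * S δ
        + ∑ j, N j a u * ((1 / 2) * ∑ δ, GbarInv u (Sum.inl j) δ * S δ)
        = (1 / 2) * ∑ d, hinv u a d * S (Sum.inr d) := by
    calc _ = (1 / 2) * ∑ δ, (GbarInv u (Sum.inr a) δ
          + ∑ j, N j a u * GbarInv u (Sum.inl j) δ) * S δ := by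
          simp only [add_mul, Finset.sum_add_distrib, mul_add, Finset.sum_mul, Finset.mul_sum]
          rw [Finset.sum_comm (s := (Finset.univ : Finset (Fin n)))]
          congr 1
          refine Finset.sum_congr rfl fun δ _ => Finset.sum_congr rfl fun j _ => ?_
          ring
      _ = _ := by simp [row, Fintype.sum_sum_type]
  simp only [hΓ u hu, hChat u hu]
  rw [contract]
  simp only [pd, hGb4, add_comm]
end
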